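/- arXiv:1911.02643 — 4 statements merged into one kernel-verified Lean document; each statement's English description precedes it below -/
import Mathlib

section
/- Fix α ∈ (0,1) and t ≥ 0, and for X ∈ ℙ_d write d_X := tr(X^α). Define δ_t²(X,Y) := (1/2)·(1/(t+d_X) + 1/(t+d_Y)) − 1/(t + d_{(X+Y)/2}) for X, Y ∈ ℙ_d. Then δ_t²(X,Y) ≥ 0, δ_t²(X,Y) = δ_t²(Y,X), δ_t²(X,X) = 0, and √(δ_t²(X,Z)) ≤ √(δ_t²(X,Y)) + √(δ_t²(Y,Z)) for all X, Y, Z ∈ ℙ_d. -/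
open Matrix
open scoped ComplexOrder

/-- `tr g(X)` for a Hermitian matrix `X`: the sum of `g` over the eigenvalues of `X`. -/
noncomputable def traceF {d : ℕ} (g : ℝ → ℝ) (X : Matrix (Fin d) (Fin d) ℂ) : ℝ :=
  if hX : X.IsHermitian then ∑ i, g (hX.eigenvalues i) else 0

/-- `δ_t²(X,Y) = (1/2)(1/(t+d_X) + 1/(t+d_Y)) − 1/(t + d_{(X+Y)/2})`, where `d_X = tr(X^α)`. -/
noncomputable def deltaT2 {d : ℕ} (α t : ℝ) (X Y : Matrix (Fin d) (Fin d) ℂ) : ℝ :=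
  (1 / 2) * (1 / (t + traceF (fun x => x ^ α) X) + 1 / (t + traceF (fun x => x ^ α) Y))
    - 1 / (t + traceF (fun x => x ^ α) ((1 / 2 : ℝ) • (X + Y)))

theorem Matrix.det_aeval_eq_prod_roots_charpoly {n : Type*} [Fintype n] [DecidableEq n]
    (M : Matrix n n ℂ) (p : Polynomial ℂ) :
    (Polynomial.aeval M p).det = (M.charpoly.roots.map fun r => p.eval r).prod := by
  have hlin (z : ℂ) : (Polynomial.aeval M (Polynomial.X - Polynomial.C z)).det =
      (M.charpoly.roots.map fun r => (Polynomial.X - Polynomial.C z).eval r).prod := by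
    have h1 : (Polynomial.aeval M (Polynomial.X - Polynomial.C z)) = -(Matrix.scalar n z - M) := by
      simp [Matrix.algebraMap_eq_diagonal, Pi.algebraMap_def]
    have h2 := (IsAlgClosed.splits M.charpoly).eq_prod_roots_of_monic M.charpoly_monic
    have h3 : M.charpoly.roots.card = Fintype.card n := by
      rw [← (IsAlgClosed.splits M.charpoly).natDegree_eq_card_roots, M.charpoly_natDegree_eq_dim]
    have h4 : M.charpoly.eval z = (M.charpoly.roots.map fun r => z - r).prod := by
      conv_lhs => rw [h2]
      rw [Polynomial.eval_multiset_prod, Multiset.map_map]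
      simp
    have h5 := Multiset.prod_map_neg (M.charpoly.roots.map fun r => z - r)
    rw [Multiset.card_map, Multiset.map_map, h3, ← h4] at h5
    rw [h1, det_neg, ← Matrix.eval_charpoly, ← h5]
    simp
  have hp := (IsAlgClosed.splits p).eq_prod_roots
  generalize p.leadingCoeff = c at hp
  generalize p.roots = s at hp
  subst hp
  induction s using Multiset.induction with
  | empty =>
    have h3 : M.charpoly.roots.card = Fintype.card n := by
      rw [← (IsAlgClosed.splits M.charpoly).natDegree_eq_card_roots, M.charpoly_natDegree_eq_dim]
    simp [h3, Matrix.algebraMap_eq_diagonal, Pi.algebraMap_def]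
  | cons a s ih =>
    have : Polynomial.C c * (Multiset.map (fun a => Polynomial.X - Polynomial.C a) (a ::ₘ s)).prod =
      (Polynomial.X - Polynomial.C a) *
        (Polynomial.C c * (Multiset.map (fun a => Polynomial.X - Polynomial.C a) s).prod) := by
      simp; ring
    rw [this, map_mul, det_mul, ih, hlin, ← Multiset.prod_map_mul]
    simp only [Polynomial.eval_mul]

theorem Matrix.trace_pow_eq_sum_roots_charpoly {n : Type*} [Fintype n] [DecidableEq n]
    (M : Matrix n n ℂ) (k : ℕ) :
    (M ^ k).trace = (M.charpoly.roots.map fun r => r ^ k).sum := by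
  have h : (M ^ k).charpoly =
      ((M.charpoly.roots.map fun r => r ^ k).map fun r => Polynomial.X - Polynomial.C r).prod := by
    refine Polynomial.funext fun z => ?_
    rw [Matrix.eval_charpoly, Polynomial.eval_multiset_prod]
    have := M.det_aeval_eq_prod_roots_charpoly (Polynomial.C z - Polynomial.X ^ k)
    simpa [Matrix.algebraMap_eq_diagonal, Pi.algebraMap_def, Multiset.map_map,
      Function.comp_def] using this
  rw [Matrix.trace_eq_sum_roots_charpoly, h, Polynomial.roots_multiset_prod_X_sub_C]

open scoped Matrix.Norms.L2Operator in
theorem Matrix.hasSum_re_trace_pow_div {n : Type*} [Fintype n] [DecidableEq n]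
    (M : Matrix n n ℂ) (hM : ‖M‖ < 1) :
    HasSum (fun k : ℕ => ((M ^ (k + 1)).trace).re / (k + 1)) (-Real.log ‖(1 - M).det‖) := by
  have hr : ∀ r ∈ M.charpoly.roots, ‖r‖ < 1 := fun r hr => by
    have : r ∈ spectrum ℂ M :=
      Matrix.mem_spectrum_iff_isRoot_charpoly.2 (Polynomial.isRoot_of_mem_roots hr)
    rcases isEmpty_or_nonempty n with h | h
    · simp at this
    · exact (spectrum.norm_le_norm_of_mem this).trans_lt hM
  have hdet : (1 - M).det = (M.charpoly.roots.map fun r => 1 - r).prod := by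
    have := M.det_aeval_eq_prod_roots_charpoly (1 - Polynomial.X)
    simpa only [map_sub, map_one, Polynomial.aeval_X, Polynomial.eval_sub, Polynomial.eval_one,
      Polynomial.eval_X] using this
  simp_rw [M.trace_pow_eq_sum_roots_charpoly, hdet]
  generalize M.charpoly.roots = s at hr
  induction s using Multiset.induction with
  | empty => simp
  | cons a s ih =>
    have ha : ‖a‖ < 1 := hr a (by simp)
    have hs : ∀ r ∈ s, ‖r‖ < 1 := fun r h => hr r (by simp [h])
    have h0 : ∀ r : ℂ, ‖r‖ < 1 → (1 - r) ≠ 0 := by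
      rintro r hr h
      rw [sub_eq_zero] at h
      simp [← h] at hr
    have hs0 : (s.map fun r => 1 - r).prod ≠ 0 := by
      rw [Ne, Multiset.prod_eq_zero_iff]
      intro h
      obtain ⟨r, hr, h⟩ := Multiset.mem_map.1 h
      exact h0 r (hs r hr) h
    have h1 := (Complex.hasSum_re (Complex.hasSum_taylorSeries_neg_log' ha)).add (ih hs)
    convert h1 using 1
    · ext k
      have : a ^ (k + 1) / ((k : ℂ) + 1) = a ^ (k + 1) / ((k + 1 : ℝ) : ℂ) := by push_cast; rfl
      rw [this, Complex.div_ofReal_re]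
      simp [add_div]
    · rw [Multiset.map_cons, Multiset.prod_cons, norm_mul,
        Real.log_mul (norm_ne_zero_iff.2 (h0 a ha)) (norm_ne_zero_iff.2 hs0), Complex.neg_re,
        Complex.log_re]
      ring

theorem Matrix.norm_sq_trace_mul_le {n : Type*} [Fintype n]
    (A B : Matrix n n ℂ) :
    ‖(A * B).trace‖ ^ 2 ≤ (A * Aᴴ).trace.re * (Bᴴ * B).trace.re := by
  have key (C D : Matrix n n ℂ) : (C * D).trace = ∑ x : n × n, C x.1 x.2 * D x.2 x.1 := by
    simp [Matrix.trace, Matrix.mul_apply, Fintype.sum_prod_type]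
  have h1 : (A * Aᴴ).trace.re = ∑ x : n × n, ‖A x.1 x.2‖ ^ 2 := by
    rw [key, Complex.re_sum]
    simp [Complex.mul_conj, Complex.normSq_eq_norm_sq, -Complex.ofReal_pow]
  have h2 : (Bᴴ * B).trace.re = ∑ x : n × n, ‖B x.2 x.1‖ ^ 2 := by
    rw [key, Complex.re_sum]
    simp [Complex.conj_mul', -Complex.ofReal_pow, ← Complex.ofReal_pow]
  rw [h1, h2, key]
  refine le_trans ?_ (Finset.sum_mul_sq_le_sq_mul_sq _ _ _)
  gcongr
  refine (norm_sum_le _ _).trans_eq ?_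
  simp

theorem conjTranspose_prod_map {ι n : Type*} [Fintype n] [DecidableEq n]
    (A : ι → Matrix n n ℂ) (hA : ∀ i, (A i).IsHermitian) (w : List ι) :
    ((w.map A).prod)ᴴ = (w.reverse.map A).prod := by
  induction w with
  | nil => simp
  | cons a w ih => simp [ih, (hA a).eq]

/-- The chessboard estimate for the trace of a product of Hermitian matrices, normalized so that the
factors have Schatten `2k`-norm at most one. -/
theorem norm_trace_prod_le_one {ι n : Type*} [Finite ι] [Fintype n] [DecidableEq n]
    (A : ι → Matrix n n ℂ) (hA : ∀ i, (A i).IsHermitian) {k : ℕ} (hk : 0 < k)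
    (h1 : ∀ i, ‖(A i ^ (2 * k)).trace‖ ≤ 1) (w : List ι) (hw : w.length = 2 * k) :
    ‖((w.map A).prod).trace‖ ≤ 1 := by
  obtain ⟨m, hm, hmax⟩ := Set.exists_max_image {l : List ι | l.length = 2 * k}
    (fun l => ‖((l.map A).prod).trace‖) (List.finite_length_eq ι _) ⟨w, hw⟩
  refine (hmax w hw).trans ?_
  set M := ‖((m.map A).prod).trace‖ with hMdef
  simp only [Set.mem_ofPred_eq] at hm hmax
  by_cases hM0 : M = 0
  · rw [hM0]; exact zero_le_one
  have hMpos : 0 < M := lt_of_le_of_ne (norm_nonneg _) (Ne.symm hM0)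
  -- reflecting the first half of a maximal word gives a maximal word
  have reflect (u v : List ι) (hu : u.length = k) (hv : v.length = k)
      (huv : M ≤ ‖(((u ++ v).map A).prod).trace‖) :
      M ≤ ‖(((u ++ u.reverse).map A).prod).trace‖ := by
    have hcs := Matrix.norm_sq_trace_mul_le (u.map A).prod (v.map A).prod
    rw [conjTranspose_prod_map A hA, conjTranspose_prod_map A hA] at hcs
    simp only [← List.prod_append, ← List.map_append] at hcs
    have hv' : (((v.reverse ++ v).map A).prod).trace.re ≤ M :=
      (Complex.re_le_norm _).trans (hmax _ (by simp [hv]; omega))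
    have hu' := Complex.re_le_norm (((u ++ u.reverse).map A).prod).trace
    have hu0 : 0 ≤ (((u ++ u.reverse).map A).prod).trace.re := by
      rw [List.map_append, List.prod_append, ← conjTranspose_prod_map A hA]
      exact (Complex.le_def.1 (Matrix.posSemidef_self_mul_conjTranspose _).trace_nonneg).1
    have : M * M ≤ (((u ++ u.reverse).map A).prod).trace.re * M := by
      calc M * M ≤ ‖(((u ++ v).map A).prod).trace‖ ^ 2 := by rw [sq]; gcongr
        _ ≤ _ := hcs
        _ ≤ _ := by gcongr
    exact (le_of_mul_le_mul_right this hMpos).trans hu'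
  have run (r : ℕ) (hr : r < k) : ∃ c : ι, ∃ v : List ι,
      (List.replicate (r + 1) c ++ v).length = 2 * k ∧
      M ≤ ‖(((List.replicate (r + 1) c ++ v).map A).prod).trace‖ := by
    induction r with
    | zero =>
      cases m with
      | nil => simp at hm; omega
      | cons c v => exact ⟨c, v, by simpa using hm, by simp [hMdef]⟩
    | succ r ih =>
      obtain ⟨c, v, hl, hM⟩ := ih (by omega)
      simp only [List.length_append, List.length_replicate] at hl
      -- split `v = v₁ ++ v₂` so that `v₂ ++ c ^ (r + 1)` has length `k`
      obtain ⟨v₁, v₂, rfl, hv₁⟩ : ∃ v₁ v₂, v = v₁ ++ v₂ ∧ v₁.length = k :=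
        ⟨v.take k, v.drop k, by simp, by simp; omega⟩
      simp only [List.length_append] at hl
      have := reflect (v₂ ++ List.replicate (r + 1) c) v₁ (by simp; omega) hv₁ (by
        convert hM using 2
        simp only [List.map_append, List.prod_append]
        rw [Matrix.trace_mul_comm, Matrix.trace_mul_comm _ (_ * _)]
        simp only [mul_assoc]
        rw [Matrix.trace_mul_comm]
        simp only [mul_assoc])
      refine ⟨c, List.replicate r c ++ (v₂.reverse ++ v₂), by simp; omega, this.trans_eq ?_⟩
      congr 1
      have e : List.replicate (r + 1 + 1) c ++ (List.replicate r c ++ (v₂.reverse ++ v₂)) =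
          List.replicate (r + 1) c ++ (List.replicate (r + 1) c ++ (v₂.reverse ++ v₂)) := by
        simp only [← List.append_assoc, List.replicate_append_replicate]
        congr 3; omega
      rw [e]
      simp only [List.reverse_append, List.reverse_replicate, List.map_append, List.prod_append]
      rw [mul_assoc, Matrix.trace_mul_comm]
      simp only [mul_assoc]
  obtain ⟨c, v, hl, hM⟩ := run (k - 1) (by omega)
  rw [Nat.sub_add_cancel hk] at hl hM
  simp only [List.length_append, List.length_replicate] at hl
  have := reflect (List.replicate k c) v (by simp) (by omega) hM
  refine this.trans (le_trans (le_of_eq ?_) (h1 c))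
  simp [two_mul, pow_add]

theorem Matrix.IsHermitian.trace_pow_even {n : Type*} [Fintype n] [DecidableEq n]
    {S : Matrix n n ℂ} (hS : S.IsHermitian) (k : ℕ) : 0 ≤ (S ^ (2 * k)).trace := by
  rw [two_mul, pow_add]
  nth_rw 2 [← (hS.pow k).eq]
  exact (Matrix.posSemidef_self_mul_conjTranspose _).trace_nonneg

theorem Matrix.IsHermitian.norm_sq_trace_mul_pow_le {n : Type*} [Fintype n] [DecidableEq n]
    {S T : Matrix n n ℂ} (hS : S.IsHermitian) (hT : T.IsHermitian) {k : ℕ} (hk : 0 < k) :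
    ‖((S * T) ^ k).trace‖ ^ 2 ≤ (S ^ (2 * k)).trace.re * (T ^ (2 * k)).trace.re := by
  have key (a b : ℝ) (ha : 0 < a) (hb : 0 < b) (haS : (S ^ (2 * k)).trace.re ≤ a ^ (2 * k))
      (hbT : (T ^ (2 * k)).trace.re ≤ b ^ (2 * k)) :
      ‖((S * T) ^ k).trace‖ ≤ a ^ k * b ^ k := by
    have hre (S : Matrix n n ℂ) (hS : S.IsHermitian) :
        ‖(S ^ (2 * k)).trace‖ = (S ^ (2 * k)).trace.re :=
      by
      have h := Complex.norm_of_nonneg' (hS.trace_pow_even k)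
      rw [← h, Complex.ofReal_re, Complex.norm_real, norm_norm]
    let A : Bool → Matrix n n ℂ := fun i => if i then (a⁻¹ : ℝ) • S else (b⁻¹ : ℝ) • T
    have hA : ∀ i, (A i).IsHermitian := by
      intro i
      cases i
      · exact hT.smul (IsSelfAdjoint.all b⁻¹)
      · exact hS.smul (IsSelfAdjoint.all a⁻¹)
    have hw := norm_trace_prod_le_one A hA hk (by
      intro i
      cases i
      · simp only [A, smul_pow, trace_smul, norm_smul, hre T hT, Bool.false_eq_true, if_false]
        rw [Real.norm_of_nonneg (by positivity), inv_pow, inv_mul_le_iff₀ (by positivity)]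
        simpa using hbT
      · simp only [A, smul_pow, trace_smul, norm_smul, hre S hS, if_true]
        rw [Real.norm_of_nonneg (by positivity), inv_pow, inv_mul_le_iff₀ (by positivity)]
        simpa using haS)
      (List.replicate k [true, false]).flatten (by simp [mul_comm])
    have e : (((List.replicate k [true, false]).flatten.map A).prod) =
        ((a⁻¹ * b⁻¹ : ℝ) ^ k) • (S * T) ^ k := by
      rw [List.map_flatten, List.prod_flatten]
      simp [A, smul_pow, smul_smul, mul_comm]
    rw [e, trace_smul, norm_smul, Real.norm_of_nonneg (by positivity), ← mul_inv, inv_pow,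
      inv_mul_le_iff₀ (by positivity)] at hw
    rw [← mul_pow]
    simpa using hw
  set s := (S ^ (2 * k)).trace.re
  set τ := (T ^ (2 * k)).trace.re
  have hs : 0 ≤ s := (Complex.le_def.1 (hS.trace_pow_even k)).1
  have ht : 0 ≤ τ := (Complex.le_def.1 (hT.trace_pow_even k)).1
  have h2 (ε : ℝ) (hε : 0 < ε) : ‖((S * T) ^ k).trace‖ ^ 2 ≤ (s + ε) * (τ + ε) := by
    have hroot (x : ℝ) (hx : 0 < x) : (x ^ ((2 * k : ℕ) : ℝ)⁻¹) ^ (2 * k) = x :=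
      Real.rpow_inv_natCast_pow hx.le (by omega)
    have := key ((s + ε) ^ ((2 * k : ℕ) : ℝ)⁻¹) ((τ + ε) ^ ((2 * k : ℕ) : ℝ)⁻¹) (by positivity)
      (by positivity) (by rw [hroot _ (by positivity)]; linarith)
      (by rw [hroot _ (by positivity)]; linarith)
    calc _ ≤ _ := pow_le_pow_left₀ (norm_nonneg _) this 2
      _ = _ := by rw [mul_pow, ← pow_mul, ← pow_mul, mul_comm k 2, hroot _ (by positivity),
        hroot _ (by positivity)]
  have hc : Filter.Tendsto (fun ε : ℝ => (s + ε) * (τ + ε)) (nhdsWithin 0 (Set.Ioi 0))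
      (nhds ((s + 0) * (τ + 0))) := by
    refine tendsto_nhdsWithin_of_tendsto_nhds (Continuous.tendsto ?_ 0)
    fun_prop
  rw [add_zero, add_zero] at hc
  exact ge_of_tendsto hc (eventually_nhdsWithin_of_forall h2)

/-- A form of Schoenberg's theorem: the reciprocals of a positive, conditionally negative kernel form
a positive semidefinite kernel. -/
theorem sum_div_nonneg_of_condNeg {ι : Type*} [Fintype ι] (F : ι → ι → ℝ) (o : ι)
    (hsymm : ∀ i j, F i j = F j i) (hpos : ∀ i, 0 < F i i)
    (hF : ∀ c : ι → ℝ, 0 ≤ ∑ i, ∑ j, c i * c j * (F i o + F j o - F i j - F o o)) (c : ι → ℝ) :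
    0 ≤ ∑ i, ∑ j, c i * c j / F i j := by
  set p : ι → ℝ := fun i => F i o - F o o / 2 with hp
  set G : Matrix ι ι ℝ := Matrix.of fun i j => F i o + F j o - F i j - F o o with hG
  have dot (A : Matrix ι ι ℝ) (c : ι → ℝ) :
      star c ⬝ᵥ (A *ᵥ c) = ∑ i, ∑ j, c i * c j * A i j := by
    simp only [dotProduct, mulVec, Finset.mul_sum, star_trivial]
    exact Finset.sum_congr rfl fun i _ => Finset.sum_congr rfl fun j _ => by ring
  have hGpsd : G.PosSemidef := by
    refine .of_dotProduct_mulVec_nonneg ?_ fun c => ?_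
    · ext i j
      simp [hG, hsymm i j]; ring
    · rw [dot]; exact hF c
  have hFG (i j) : F i j = p i + p j - G i j := by simp [hp, hG]; ring
  have hpp (i) : 0 < p i := by
    have h1 : 0 ≤ G i i := hGpsd.diag_nonneg
    have h2 := hFG i i
    have h3 := hpos i
    linarith
  let q : ι → ℝ := fun i => 1 + p i
  have hq (i) : 0 < q i := by have := hpp i; simp only [q]; linarith
  let R : Matrix ι ι ℝ := Matrix.of fun i j => ((1 - p i) * (1 - p j) + 2 * G i j) / (q i * q j)
  have hR : R.PosSemidef := by
    refine .of_dotProduct_mulVec_nonneg ?_ fun c => ?_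
    · ext i j
      have : G j i = G i j := by simpa using hGpsd.isHermitian.apply i j
      simp [R, this, mul_comm]
    · rw [dot]
      have h2 := hGpsd.dotProduct_mulVec_nonneg (fun i => c i / q i)
      rw [dot] at h2
      have : ∑ i, ∑ j, c i * c j * R i j = (∑ i, c i / q i * (1 - p i)) ^ 2 +
          2 * ∑ i, ∑ j, c i / q i * (c j / q j) * G i j := by
        rw [sq, Finset.sum_mul_sum, Finset.mul_sum, ← Finset.sum_add_distrib]
        refine Finset.sum_congr rfl fun i _ => ?_
        rw [Finset.mul_sum, ← Finset.sum_add_distrib]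
        refine Finset.sum_congr rfl fun j _ => ?_
        have := (hq i).ne'; have := (hq j).ne'
        simp only [R, Matrix.of_apply]
        field_simp
      rw [this]; positivity
  have hFR (i j) : F i j = q i * q j / 2 * (1 - R i j) := by
    rw [hFG]
    have := (hq i).ne'; have := (hq j).ne'
    simp only [R, Matrix.of_apply]
    field_simp
    simp only [q]; ring
  have hR1 (i) : R i i < 1 := by
    have h := hpos i
    rw [hFR] at h
    have : 0 < q i * q i / 2 := by have := hq i; positivity
    have := (pos_iff_pos_of_mul_pos h).1 this
    linarith
  have hRabs (i j) : |R i j| < 1 := by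
    have h := (hR.submatrix ![i, j]).det_nonneg
    have hs : R j i = R i j := by simpa using hR.isHermitian.apply i j
    rw [Matrix.det_fin_two] at h
    simp only [Matrix.submatrix_apply, Matrix.cons_val_zero, Matrix.cons_val_one, hs] at h
    have h1 : 0 ≤ R i i := hR.diag_nonneg
    have h2 : 0 ≤ R j j := hR.diag_nonneg
    rw [← sq_lt_one_iff_abs_lt_one]
    nlinarith [hR1 i, hR1 j]
  have hpow (k : ℕ) (c : ι → ℝ) : 0 ≤ ∑ i, ∑ j, c i * c j * R i j ^ k := by
    have : (Matrix.of fun i j => R i j ^ k).PosSemidef := by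
      induction k with
      | zero =>
        refine .of_dotProduct_mulVec_nonneg (by ext i j; simp) fun c => ?_
        rw [dot]
        simp only [pow_zero, Matrix.of_apply, mul_one]
        rw [← Finset.sum_mul_sum]
        exact mul_self_nonneg _
      | succ k ih =>
        have e : (Matrix.of fun i j => R i j ^ (k + 1)) = (Matrix.of fun i j => R i j ^ k) ⊙ R := by
          ext i j; simp [pow_succ]
        rw [e]
        exact ih.hadamard hR
    have h := this.dotProduct_mulVec_nonneg c
    rwa [dot] at h
  have hsum : HasSum (fun k : ℕ => 2 * ∑ i, ∑ j, c i / q i * (c j / q j) * R i j ^ k)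
      (2 * ∑ i, ∑ j, c i / q i * (c j / q j) * (1 - R i j)⁻¹) :=
    (hasSum_sum fun i _ => hasSum_sum fun j _ =>
      (hasSum_geometric_of_abs_lt_one (hRabs i j)).mul_left _).mul_left 2
  have : ∑ i, ∑ j, c i * c j / F i j =
      2 * ∑ i, ∑ j, c i / q i * (c j / q j) * (1 - R i j)⁻¹ := by
    rw [Finset.mul_sum]
    refine Finset.sum_congr rfl fun i _ => ?_
    rw [Finset.mul_sum]
    refine Finset.sum_congr rfl fun j _ => ?_
    rw [hFR]
    have h1 := (hq i).ne'; have h2 := (hq j).ne'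
    have h3 : 1 - R i j ≠ 0 := by have := (abs_lt.1 (hRabs i j)).2; linarith
    field_simp
  rw [this]
  exact hsum.nonneg fun k => mul_nonneg zero_le_two (hpow k _)

theorem sqrt_le_sqrt_add_sqrt_of_quadratic_nonneg {a b c : ℝ}
    (h : ∀ x z : ℝ, 0 ≤ x ^ 2 * a + z ^ 2 * b + x * z * (a + b - c)) : √c ≤ √a + √b := by
  have ha : 0 ≤ a := by simpa using h 1 0
  have hb : 0 ≤ b := by simpa using h 0 1
  have h2 (ε : ℝ) (hε : 0 < ε) : c ≤ (√a + √b + 2 * ε) ^ 2 := by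
    have := h (√b + ε) (√a + ε)
    have hA := Real.sq_sqrt ha
    have hB := Real.sq_sqrt hb
    have h0A := Real.sqrt_nonneg a
    have h0B := Real.sqrt_nonneg b
    set A := √a
    set B := √b
    rw [← hA, ← hB] at this
    have h3 : 0 < (B + ε) * (A + ε) := by positivity
    have h4 : c * ((B + ε) * (A + ε)) ≤ (A + B + 2 * ε) ^ 2 * ((B + ε) * (A + ε)) := by
      have e : 0 ≤ (A + ε) ^ 2 - A ^ 2 := by nlinarith
      have f : 0 ≤ (B + ε) ^ 2 - B ^ 2 := by nlinarith
      nlinarith [mul_nonneg e (sq_nonneg (B + ε)), mul_nonneg f (sq_nonneg (A + ε)),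
        mul_nonneg e h3.le, mul_nonneg f h3.le]
    exact le_of_mul_le_mul_right h4 h3
  have hc : Filter.Tendsto (fun ε : ℝ => (√a + √b + 2 * ε) ^ 2) (nhdsWithin 0 (Set.Ioi 0))
      (nhds ((√a + √b + 2 * 0) ^ 2)) := by
    refine tendsto_nhdsWithin_of_tendsto_nhds (Continuous.tendsto ?_ 0)
    fun_prop
  rw [mul_zero, add_zero] at hc
  exact Real.sqrt_le_iff.2 ⟨by positivity, ge_of_tendsto hc (eventually_nhdsWithin_of_forall h2)⟩

theorem quadratic_form_nonneg_of_sq_le_mul {s t r x z : ℝ} (hs : 0 ≤ s) (ht : 0 ≤ t)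
    (h : r ^ 2 ≤ s * t) :
    0 ≤ x ^ 2 * s + z ^ 2 * t + 2 * (x * z) * r := by
  have h1 : 0 ≤ x ^ 2 * s + z ^ 2 * t := by positivity
  have h2 : |2 * (x * z) * r| ≤ x ^ 2 * s + z ^ 2 * t := by
    refine abs_le_of_sq_le_sq ?_ h1
    nlinarith [mul_le_mul_of_nonneg_left h (sq_nonneg (2 * (x * z))),
      sq_nonneg (x ^ 2 * s - z ^ 2 * t)]
  linarith [(abs_le.1 h2).1]

section
variable {n : Type*} [Fintype n] [DecidableEq n]

/-- The Cayley transform `(X - 1)(X + 1)⁻¹ = 1 - 2 (X + 1)⁻¹`. -/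
noncomputable def cayley (X : Matrix n n ℂ) : Matrix n n ℂ := 1 - (2 : ℝ) • (X + 1)⁻¹

theorem isHermitian_cayley {X : Matrix n n ℂ} (hX : X.PosDef) : (cayley X).IsHermitian :=
  isHermitian_one.sub (((hX.isHermitian.add isHermitian_one).inv).smul (IsSelfAdjoint.all (2 : ℝ)))

open scoped Matrix.Norms.L2Operator MatrixOrder in
theorem norm_cayley_lt_one {X : Matrix n n ℂ} (hX : X.PosDef) : ‖cayley X‖ < 1 := by
  have hsp : ∀ x ∈ spectrum ℝ X, 0 < x := fun x hx => by
    rw [hX.isHermitian.spectrum_real_eq_range_eigenvalues] at hx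
    obtain ⟨i, rfl⟩ := hx
    exact hX.eigenvalues_pos i
  have hsa : IsSelfAdjoint X := hX.isHermitian
  have h1 : X + 1 = cfc (fun x : ℝ => x + 1) X := by
    rw [cfc_add_const (1 : ℝ) (fun x : ℝ => x) X, cfc_id' ℝ X, map_one]
  have hne : ∀ x ∈ spectrum ℝ X, x + 1 ≠ 0 := fun x hx => by have := hsp x hx; positivity
  have hcont : ContinuousOn (fun x : ℝ => (x + 1)⁻¹) (spectrum ℝ X) :=
    ContinuousOn.inv₀ (by fun_prop) hne
  have h2 : (X + 1)⁻¹ = cfc (fun x : ℝ => (x + 1)⁻¹) X := by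
    refine Matrix.inv_eq_left_inv ?_
    rw [h1, ← cfc_mul _ _ X hcont (by fun_prop), ← cfc_one ℝ X]
    exact cfc_congr fun x hx => by simp [hne x hx]
  have h3 : cayley X = cfc (fun x : ℝ => 1 - 2 * (x + 1)⁻¹) X := by
    rw [cfc_sub (fun _ : ℝ => (1 : ℝ)) _ X (by fun_prop) (by fun_prop),
      cfc_const_mul _ _ X hcont, cfc_const_one ℝ X, cayley, h2]
  rw [h3]
  refine norm_cfc_lt one_pos fun x hx => ?_
  have hx0 := hsp x hx
  have e : 1 - 2 * (x + 1)⁻¹ = (x - 1) / (x + 1) := by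
    have := hne x hx
    field_simp; ring
  rw [e, Real.norm_eq_abs, abs_div, abs_of_pos (show 0 < x + 1 by linarith),
    div_lt_one (by linarith), abs_lt]
  constructor <;> linarith

theorem log_norm_det_one_sub_cayley_mul {X Y : Matrix n n ℂ} (hX : X.PosDef) (hY : Y.PosDef) :
    -Real.log ‖(1 - cayley X * cayley Y).det‖ = Real.log ‖(X + 1).det‖ + Real.log ‖(Y + 1).det‖ -
      Real.log ‖(X + Y).det‖ - Real.log ‖(1 + 1 : Matrix n n ℂ).det‖ := by
  have h1 : (1 : Matrix n n ℂ).PosDef := .one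
  have dX := (hX.add h1).det_pos.ne'
  have dY := (hY.add h1).det_pos.ne'
  have dXY := (hX.add hY).det_pos.ne'
  have d1 := (h1.add h1).det_pos.ne'
  have key : (X + 1) * (1 - cayley X * cayley Y) * (Y + 1) = (1 + 1) * (X + Y) := by
    have e1 : (X + 1) * cayley X = X - 1 := by
      rw [cayley, mul_sub, mul_smul_comm, Matrix.mul_nonsing_inv _ (by simpa using dX), two_smul]
      simp
    have e2 : cayley Y * (Y + 1) = Y - 1 := by
      rw [cayley, sub_mul, smul_mul_assoc, Matrix.nonsing_inv_mul _ (by simpa using dY), two_smul]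
      simp
    calc _ = (X + 1) * (Y + 1) - ((X + 1) * cayley X) * (cayley Y * (Y + 1)) := by noncomm_ring
      _ = _ := by rw [e1, e2]; noncomm_ring
  have hdet := congrArg (fun A => ‖Matrix.det A‖) key
  simp only [det_mul, norm_mul] at hdet
  have d2 : ‖(1 - cayley X * cayley Y).det‖ ≠ 0 := by
    intro h
    rw [h] at hdet
    simp only [mul_zero, zero_mul, zero_eq_mul, norm_eq_zero] at hdet
    tauto
  have := congrArg Real.log hdet
  rw [← norm_ne_zero_iff] at dX dY dXY d1
  rw [Real.log_mul (mul_ne_zero dX d2) dY, Real.log_mul dX d2, Real.log_mul d1 dXY] at this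
  linarith

open scoped Matrix.Norms.L2Operator in
theorem log_norm_det_add_one_quadratic_nonneg {X Y : Matrix n n ℂ} (hX : X.PosDef) (hY : Y.PosDef)
    (x z : ℝ) :
    0 ≤ x ^ 2 * (2 * Real.log ‖(X + 1).det‖ - Real.log ‖(X + X).det‖ -
          Real.log ‖(1 + 1 : Matrix n n ℂ).det‖) +
        z ^ 2 * (2 * Real.log ‖(Y + 1).det‖ - Real.log ‖(Y + Y).det‖ -
          Real.log ‖(1 + 1 : Matrix n n ℂ).det‖) +
        2 * (x * z) * (Real.log ‖(X + 1).det‖ + Real.log ‖(Y + 1).det‖ - Real.log ‖(X + Y).det‖ -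
          Real.log ‖(1 + 1 : Matrix n n ℂ).det‖) := by
  rw [← log_norm_det_one_sub_cayley_mul hX hY, two_mul (Real.log ‖(X + 1).det‖),
    two_mul (Real.log ‖(Y + 1).det‖), ← log_norm_det_one_sub_cayley_mul hX hX,
    ← log_norm_det_one_sub_cayley_mul hY hY]
  have hS := isHermitian_cayley hX
  have hT := isHermitian_cayley hY
  have nS := norm_cayley_lt_one hX
  have nT := norm_cayley_lt_one hY
  set S := cayley X
  set T := cayley Y
  have hn (A B : Matrix n n ℂ) (hA : ‖A‖ < 1) (hB : ‖B‖ < 1) : ‖A * B‖ < 1 :=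
    (norm_mul_le A B).trans_lt (mul_lt_one_of_nonneg_of_lt_one_left (norm_nonneg _) hA hB.le)
  have hsum := (((Matrix.hasSum_re_trace_pow_div _ (hn S S nS nS)).mul_left (x ^ 2)).add
    ((Matrix.hasSum_re_trace_pow_div _ (hn T T nT nT)).mul_left (z ^ 2))).add
    ((Matrix.hasSum_re_trace_pow_div _ (hn S T nS nT)).mul_left (2 * (x * z)))
  refine hsum.nonneg fun k => ?_
  have h := hS.norm_sq_trace_mul_pow_le hT k.succ_pos
  have hs := (Complex.le_def.1 (hS.trace_pow_even (k + 1))).1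
  have ht := (Complex.le_def.1 (hT.trace_pow_even (k + 1))).1
  rw [← sq, ← sq, ← pow_mul, ← pow_mul]
  have hr : ((S * T) ^ (k + 1)).trace.re ^ 2 ≤ ‖((S * T) ^ (k + 1)).trace‖ ^ 2 :=
    sq_le_sq.2 (by rw [abs_norm]; exact Complex.abs_re_le_norm _)
  have := quadratic_form_nonneg_of_sq_le_mul (x := x) (z := z) hs ht (hr.trans h)
  have h3 : 0 ≤ (x ^ 2 * (S ^ (2 * (k + 1))).trace.re + z ^ 2 * (T ^ (2 * (k + 1))).trace.re +
      2 * (x * z) * ((S * T) ^ (k + 1)).trace.re) / ((k : ℝ) + 1) := by positivity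
  refine h3.trans_eq ?_
  ring

theorem log_norm_det_add_quadratic_nonneg {X Y Z : Matrix n n ℂ} (hX : X.PosDef) (hY : Y.PosDef)
    (hZ : Z.PosDef) (x z : ℝ) :
    0 ≤ x ^ 2 * (2 * Real.log ‖(X + Z).det‖ - Real.log ‖(X + X).det‖ - Real.log ‖(Z + Z).det‖) +
        z ^ 2 * (2 * Real.log ‖(Y + Z).det‖ - Real.log ‖(Y + Y).det‖ - Real.log ‖(Z + Z).det‖) +
        2 * (x * z) * (Real.log ‖(X + Z).det‖ + Real.log ‖(Y + Z).det‖ - Real.log ‖(X + Y).det‖ -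
          Real.log ‖(Z + Z).det‖) := by
  obtain ⟨C, hC, hZC⟩ : ∃ C : Matrix n n ℂ, IsUnit C ∧ Z = Cᴴ * C := by
    open scoped MatrixOrder in
    exact CStarAlgebra.isStrictlyPositive_iff_eq_star_mul_self.mp hZ.isStrictlyPositive
  have hdC := (Matrix.isUnit_iff_isUnit_det C).1 hC
  have hdC' : IsUnit (Cᴴ).det := by rw [det_conjTranspose]; exact hdC.star
  have hconj {W : Matrix n n ℂ} (hW : W.PosDef) :
      ∃ V : Matrix n n ℂ, V.PosDef ∧ W = Cᴴ * V * C := by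
    refine ⟨(C⁻¹)ᴴ * W * C⁻¹, hW.conjTranspose_mul_mul_same ?_, ?_⟩
    · exact Matrix.mulVec_injective_of_isUnit (by simpa using hC)
    · have e : Cᴴ * (C⁻¹)ᴴ = 1 := by
        rw [← conjTranspose_mul, Matrix.nonsing_inv_mul _ hdC, conjTranspose_one]
      calc W = 1 * W * 1 := by simp
        _ = (Cᴴ * (C⁻¹)ᴴ) * W * (C⁻¹ * C) := by rw [e, Matrix.nonsing_inv_mul _ hdC]
        _ = _ := by simp only [mul_assoc]
  obtain ⟨X', hX', rfl⟩ := hconj hX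
  obtain ⟨Y', hY', rfl⟩ := hconj hY
  have hl {A B : Matrix n n ℂ} (hA : A.PosDef) (hB : B.PosDef) :
      Real.log ‖(Cᴴ * A * C + Cᴴ * B * C).det‖ =
        Real.log ‖(A + B).det‖ + (Real.log ‖(Cᴴ).det‖ + Real.log ‖C.det‖) := by
    have h1 : ‖(A + B).det‖ ≠ 0 := norm_ne_zero_iff.2 (hA.add hB).det_pos.ne'
    have h2 : ‖C.det‖ ≠ 0 := norm_ne_zero_iff.2 hdC.ne_zero
    have h3 : ‖(Cᴴ).det‖ ≠ 0 := norm_ne_zero_iff.2 hdC'.ne_zero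
    rw [← add_mul, ← mul_add, det_mul, det_mul, norm_mul, norm_mul,
      Real.log_mul (mul_ne_zero h3 h1) h2, Real.log_mul h3 h1]
    ring
  have hZ1 : Z = Cᴴ * 1 * C := by rw [hZC, mul_one]
  rw [hZ1, hl hX' .one, hl hX' hX', hl .one .one, hl hY' .one, hl hY' hY', hl hX' hY']
  refine (log_norm_det_add_one_quadratic_nonneg hX' hY' x z).trans_eq ?_
  ring

end

open MeasureTheory Set in
theorem integrableOn_log_one_add_div_mul_rpow {α x : ℝ} (hα : α ∈ Ioo (0 : ℝ) 1) (hx : 0 < x) :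
    IntegrableOn (fun s : ℝ => Real.log (1 + x / s) * s ^ (α - 1)) (Ioi 0) := by
  obtain ⟨h0, h1⟩ := hα
  have hmeas : Measurable fun s : ℝ => Real.log (1 + x / s) * s ^ (α - 1) := by fun_prop
  have hlog (s : ℝ) (hs : 0 < s) : 0 ≤ Real.log (1 + x / s) :=
    Real.log_nonneg (by have : 0 < x / s := by positivity
                        linarith)
  rw [← Ioc_union_Ioi_eq_Ioi (zero_le_one (α := ℝ))]
  refine IntegrableOn.union ?_ ?_
  · have hInt : IntegrableOn (fun s : ℝ => (1 + x) ^ (α / 2) / (α / 2) * s ^ (α / 2 - 1))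
        (Ioc 0 1) := by
      rw [← intervalIntegrable_iff_integrableOn_Ioc_of_le zero_le_one]
      exact (intervalIntegral.intervalIntegrable_rpow' (by linarith)).const_mul _
    refine Integrable.mono' hInt hmeas.aestronglyMeasurable ?_
    refine (ae_restrict_iff' measurableSet_Ioc).2 (ae_of_all _ fun s hs => ?_)
    have hs0 := hs.1
    rw [Real.norm_of_nonneg (mul_nonneg (hlog s hs0) (by positivity))]
    have hle : 1 + x / s ≤ (1 + x) / s := by
      rw [add_div]
      gcongr
      exact (one_le_div hs0).2 hs.2
    calc Real.log (1 + x / s) * s ^ (α - 1)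
        ≤ ((1 + x) / s) ^ (α / 2) / (α / 2) * s ^ (α - 1) := by
          gcongr
          refine (Real.log_le_rpow_div (by positivity) (by linarith : 0 < α / 2)).trans ?_
          gcongr
      _ = (1 + x) ^ (α / 2) / (α / 2) * s ^ (α / 2 - 1) := by
          have e : s ^ (α / 2 - 1) = s ^ (α - 1) / s ^ (α / 2) := by
            rw [← Real.rpow_sub hs0]
            congr 1
            ring
          rw [Real.div_rpow (by linarith) hs0.le, e]
          ring
  · have hInt : IntegrableOn (fun s : ℝ => x * s ^ (α - 2)) (Ioi 1) :=
      (integrableOn_Ioi_rpow_of_lt (by linarith) one_pos).const_mul x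
    refine Integrable.mono' hInt hmeas.aestronglyMeasurable ?_
    refine (ae_restrict_iff' measurableSet_Ioi).2 (ae_of_all _ fun s hs => ?_)
    have hs0 : (0 : ℝ) < s := one_pos.trans hs
    rw [Real.norm_of_nonneg (mul_nonneg (hlog s hs0) (by positivity))]
    calc Real.log (1 + x / s) * s ^ (α - 1) ≤ x / s * s ^ (α - 1) := by
          gcongr
          have := Real.log_le_sub_one_of_pos (show 0 < 1 + x / s by positivity)
          linarith
      _ = x * s ^ (α - 2) := by
          have e : s ^ (α - 2) = s ^ (α - 1) / s := by
            rw [← Real.rpow_sub_one hs0.ne']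
            congr 1
            ring
          rw [e]
          ring

open MeasureTheory Set in
theorem integral_log_one_add_div_mul_rpow (α : ℝ) {x : ℝ} (hx : 0 < x) :
    ∫ s in Ioi (0 : ℝ), Real.log (1 + x / s) * s ^ (α - 1) =
      (∫ s in Ioi (0 : ℝ), Real.log (1 + 1 / s) * s ^ (α - 1)) * x ^ α := by
  have h := integral_comp_mul_left_Ioi
    (fun s : ℝ => Real.log (1 + x / s) * s ^ (α - 1)) 0 hx
  rw [mul_zero, smul_eq_mul] at h
  have h2 : ∫ s in Ioi (0 : ℝ), Real.log (1 + x / (x * s)) * (x * s) ^ (α - 1) =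
      x ^ (α - 1) * ∫ s in Ioi (0 : ℝ), Real.log (1 + 1 / s) * s ^ (α - 1) := by
    rw [← integral_const_mul]
    refine setIntegral_congr_fun measurableSet_Ioi fun s hs => ?_
    have hs0 : (0 : ℝ) < s := hs
    rw [Real.mul_rpow hx.le hs0.le, show x / (x * s) = 1 / s by field_simp]
    ring
  rw [h2, Real.rpow_sub_one hx.ne', eq_inv_mul_iff_mul_eq₀ hx.ne'] at h
  rw [← h]
  field_simp

open MeasureTheory Set in
theorem integral_log_one_add_one_div_mul_rpow_pos {α : ℝ} (hα : α ∈ Ioo (0 : ℝ) 1) :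
    0 < ∫ s in Ioi (0 : ℝ), Real.log (1 + 1 / s) * s ^ (α - 1) := by
  have hpos (s : ℝ) (hs : s ∈ Ioi (0 : ℝ)) : 0 < Real.log (1 + 1 / s) * s ^ (α - 1) := by
    have hs0 : (0 : ℝ) < s := hs
    refine mul_pos (Real.log_pos ?_) (by positivity)
    have : 0 < 1 / s := by positivity
    linarith
  rw [setIntegral_pos_iff_support_of_nonneg_ae
    ((ae_restrict_iff' measurableSet_Ioi).2 (ae_of_all _ fun s hs => (hpos s hs).le))
    (integrableOn_log_one_add_div_mul_rpow hα one_pos)]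
  have hsub : Ioi 0 ⊆ Function.support fun s : ℝ => Real.log (1 + 1 / s) * s ^ (α - 1) :=
    fun s hs => (hpos s hs).ne'
  rw [inter_eq_self_of_subset_right hsub]
  simp

theorem log_norm_det_add_smul_one {n : Type*} [Fintype n] [DecidableEq n] {X : Matrix n n ℂ}
    (hX : X.PosDef) {s : ℝ} (hs : 0 < s) :
    Real.log ‖(X + s • (1 : Matrix n n ℂ)).det‖ =
      ∑ i, Real.log (1 + hX.isHermitian.eigenvalues i / s) + Fintype.card n * Real.log s := by
  have h1 : ‖(X + s • (1 : Matrix n n ℂ)).det‖ = ∏ i, (hX.isHermitian.eigenvalues i + s) := by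
    have e : X + s • (1 : Matrix n n ℂ) = -(Matrix.scalar n (-s : ℂ) - X) := by
      ext i j
      simp [Matrix.diagonal_apply, Matrix.one_apply]
      split_ifs <;> simp
    rw [e, det_neg, ← eval_charpoly, hX.isHermitian.charpoly_eq, Polynomial.eval_prod, norm_mul,
      norm_prod]
    simp only [norm_pow, norm_neg, norm_one, one_pow, one_mul, Polynomial.eval_sub,
      Polynomial.eval_X, Polynomial.eval_C]
    refine Finset.prod_congr rfl fun i _ => ?_
    have := hX.eigenvalues_pos i
    rw [← norm_neg, neg_sub, sub_neg_eq_add]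
    have h : ((hX.isHermitian.eigenvalues i : ℂ) + (s : ℂ)) =
      ((hX.isHermitian.eigenvalues i + s : ℝ) : ℂ) := by push_cast; rfl
    refine (congrArg norm h).trans ?_
    rw [Complex.norm_real, Real.norm_of_nonneg (by positivity)]
  rw [h1, Real.log_prod fun i _ => (add_pos (hX.eigenvalues_pos i) hs).ne']
  have hsplit (i : n) : Real.log (hX.isHermitian.eigenvalues i + s) =
      Real.log (1 + hX.isHermitian.eigenvalues i / s) + Real.log s := by
    have := hX.eigenvalues_pos i
    rw [← Real.log_mul (by positivity) hs.ne']
    congr 1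
    field_simp
    ring
  simp_rw [hsplit, Finset.sum_add_distrib]
  simp

open MeasureTheory Set in
theorem sum_mul_traceF_rpow_nonneg {d : ℕ} {ι : Type*} [Fintype ι] {α : ℝ}
    (hα : α ∈ Ioo (0 : ℝ) 1) (w : ι → ℝ) (hw : ∑ k, w k = 0)
    (A : ι → Matrix (Fin d) (Fin d) ℂ) (hA : ∀ k, (A k).PosDef)
    (h : ∀ s : ℝ, 0 < s →
      0 ≤ ∑ k, w k * Real.log ‖(A k + s • (1 : Matrix (Fin d) (Fin d) ℂ)).det‖) :
    0 ≤ ∑ k, w k * traceF (fun x => x ^ α) (A k) := by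
  have hc := integral_log_one_add_one_div_mul_rpow_pos hα
  set c := ∫ s in Ioi (0 : ℝ), Real.log (1 + 1 / s) * s ^ (α - 1)
  have hInt (k i) := integrableOn_log_one_add_div_mul_rpow hα ((hA k).eigenvalues_pos i)
  have key : c * ∑ k, w k * traceF (fun x => x ^ α) (A k) = ∫ s in Ioi (0 : ℝ),
      ∑ k, w k * ∑ i, Real.log (1 + (hA k).isHermitian.eigenvalues i / s) * s ^ (α - 1) := by
    rw [integral_finsetSum _ fun k _ => (integrable_finsetSum _ fun i _ => hInt k i).const_mul _,
      Finset.mul_sum]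
    refine Finset.sum_congr rfl fun k _ => ?_
    rw [integral_const_mul, integral_finsetSum _ fun i _ => hInt k i, traceF,
      dif_pos (hA k).isHermitian, mul_left_comm, Finset.mul_sum]
    congr 1
    exact Finset.sum_congr rfl fun i _ =>
      (integral_log_one_add_div_mul_rpow α ((hA k).eigenvalues_pos i)).symm
  refine nonneg_of_mul_nonneg_right (key ▸ ?_) hc
  refine setIntegral_nonneg measurableSet_Ioi fun s hs => ?_
  have hs0 : (0 : ℝ) < s := hs
  have h1 := h s hs0
  simp_rw [fun k => log_norm_det_add_smul_one (hA k) hs0, mul_add, Finset.sum_add_distrib,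
    ← Finset.sum_mul, hw, zero_mul, add_zero] at h1
  simp_rw [← Finset.sum_mul, ← mul_assoc, ← Finset.sum_mul]
  positivity

theorem traceF_rpow_quadratic_nonneg {d : ℕ} {α : ℝ} (hα : α ∈ Set.Ioo (0 : ℝ) 1)
    {X Y Z : Matrix (Fin d) (Fin d) ℂ} (hX : X.PosDef) (hY : Y.PosDef) (hZ : Z.PosDef)
    (x z : ℝ) :
    letI T := fun A B : Matrix (Fin d) (Fin d) ℂ =>
      traceF (fun x => x ^ α) ((1 / 2 : ℝ) • (A + B))
    0 ≤ x ^ 2 * (2 * T X Z - T X X - T Z Z) + z ^ 2 * (2 * T Y Z - T Y Y - T Z Z) +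
      2 * (x * z) * (T X Z + T Y Z - T X Y - T Z Z) := by
  have hmid {A B : Matrix (Fin d) (Fin d) ℂ} (hA : A.PosDef) (hB : B.PosDef) :
      ((1 / 2 : ℝ) • (A + B)).PosDef := (hA.add hB).smul (by norm_num)
  have h := sum_mul_traceF_rpow_nonneg hα
    ![2 * x ^ 2 + 2 * (x * z), -x ^ 2, -x ^ 2 - z ^ 2 - 2 * (x * z), 2 * z ^ 2 + 2 * (x * z),
      -z ^ 2, -(2 * (x * z))]
    (by simp [Fin.sum_univ_succ]; ring)
    (fun k => (1 / 2 : ℝ) • (![X, X, Z, Y, Y, X] k + ![Z, X, Z, Z, Y, Y] k))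
    (by intro k; fin_cases k <;> exact hmid (by assumption) (by assumption))
    (fun s hs => by
      have hs2 : ((s / 2) • (1 : Matrix (Fin d) (Fin d) ℂ)).PosDef := PosDef.one.smul (by positivity)
      have hsh {A : Matrix (Fin d) (Fin d) ℂ} (hA : A.PosDef) :
        ((1 / 2 : ℝ) • A + (s / 2) • (1 : Matrix (Fin d) (Fin d) ℂ)).PosDef :=
          (hA.smul (by norm_num)).add hs2
      have e (A B : Matrix (Fin d) (Fin d) ℂ) :
          ((1 / 2 : ℝ) • A + (s / 2) • (1 : Matrix (Fin d) (Fin d) ℂ)) +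
          ((1 / 2 : ℝ) • B + (s / 2) • (1 : Matrix (Fin d) (Fin d) ℂ)) =
            (1 / 2 : ℝ) • (A + B) + s • (1 : Matrix (Fin d) (Fin d) ℂ) := by
        module
      have := log_norm_det_add_quadratic_nonneg (hsh hX) (hsh hY) (hsh hZ) x z
      simp only [e] at this
      refine this.trans_eq ?_
      simp [Fin.sum_univ_succ]
      ring)
  refine h.trans_eq ?_
  simp [Fin.sum_univ_succ]
  ring

theorem traceF_rpow_pos {d : ℕ} [NeZero d] (α : ℝ) {X : Matrix (Fin d) (Fin d) ℂ}
    (hX : X.PosDef) : 0 < traceF (fun x => x ^ α) X := by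
  rw [traceF, dif_pos hX.isHermitian]
  exact Finset.sum_pos (fun i _ => Real.rpow_pos_of_pos (hX.eigenvalues_pos i) α)
    Finset.univ_nonempty

theorem deltaT2_comm {d : ℕ} (α t : ℝ) (X Y : Matrix (Fin d) (Fin d) ℂ) :
    deltaT2 α t X Y = deltaT2 α t Y X := by
  rw [deltaT2, deltaT2, add_comm X Y, add_comm (1 / (t + traceF (fun x => x ^ α) X))]

theorem deltaT2_self {d : ℕ} (α t : ℝ) (X : Matrix (Fin d) (Fin d) ℂ) :
    deltaT2 α t X X = 0 := by
  have : (1 / 2 : ℝ) • (X + X) = X := by module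
  rw [deltaT2, this]
  ring

theorem deltaT2_quadratic_nonneg {d : ℕ} {α t : ℝ} (hα : α ∈ Set.Ioo (0 : ℝ) 1) (ht : 0 ≤ t)
    {X Y Z : Matrix (Fin d) (Fin d) ℂ} (hX : X.PosDef) (hY : Y.PosDef) (hZ : Z.PosDef)
    (x z : ℝ) :
    0 ≤ x ^ 2 * deltaT2 α t X Y + z ^ 2 * deltaT2 α t Y Z +
      x * z * (deltaT2 α t X Y + deltaT2 α t Y Z - deltaT2 α t X Z) := by
  rcases Nat.eq_zero_or_pos d with rfl | hd
  · have h0 (A B : Matrix (Fin 0) (Fin 0) ℂ) : deltaT2 α t A B = 0 := by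
      rw [Subsingleton.elim B A, deltaT2_self]
    simp [h0]
  have : NeZero d := ⟨hd.ne'⟩
  let pt : Fin 3 → Matrix (Fin d) (Fin d) ℂ := ![X, Y, Z]
  have hpt (i) : (pt i).PosDef := by fin_cases i <;> assumption
  have hself (A : Matrix (Fin d) (Fin d) ℂ) : (1 / 2 : ℝ) • (A + A) = A := by module
  have h := sum_div_nonneg_of_condNeg
    (fun i j => t + traceF (fun x => x ^ α) ((1 / 2 : ℝ) • (pt i + pt j))) 1
    (fun i j => by simp only [add_comm])
    (fun i => by rw [hself]; have := traceF_rpow_pos α (hpt i); positivity)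
    (fun c => by
      have h := traceF_rpow_quadratic_nonneg hα hX hZ hY (c 0) (c 2)
      simp only at h
      refine h.trans_eq ?_
      simp only [Fin.sum_univ_three, pt, Matrix.cons_val_zero, Matrix.cons_val_one,
        Matrix.cons_val]
      rw [add_comm Y X, add_comm Z X, add_comm Z Y]
      ring)
    ![x, -(x + z), z]
  simp only [Fin.sum_univ_three, pt, Matrix.cons_val_zero, Matrix.cons_val_one,
    Matrix.cons_val, hself] at h
  rw [add_comm Y X, add_comm Z X, add_comm Z Y] at h
  simp only [deltaT2]
  refine (mul_nonneg (by norm_num : (0 : ℝ) ≤ 1 / 2) h).trans_eq ?_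
  ring

/-- For `α ∈ (0,1)` and `t ≥ 0`, `δ_t` is a distance metric on `ℙ_d`. -/
theorem deltaT2_sqrt_metric {d : ℕ} (α t : ℝ) (hα : α ∈ Set.Ioo (0:ℝ) 1) (ht : 0 ≤ t) :
    ∀ X Y Z : Matrix (Fin d) (Fin d) ℂ, X.PosDef → Y.PosDef → Z.PosDef →
      0 ≤ deltaT2 α t X Y ∧
      deltaT2 α t X Y = deltaT2 α t Y X ∧
      deltaT2 α t X X = 0 ∧
      Real.sqrt (deltaT2 α t X Z) ≤
        Real.sqrt (deltaT2 α t X Y) + Real.sqrt (deltaT2 α t Y Z) := by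
  intro X Y Z hX hY hZ
  have h := deltaT2_quadratic_nonneg hα ht hX hY hZ
  exact ⟨by simpa using h 1 0, deltaT2_comm α t X Y, deltaT2_self α t X,
    sqrt_le_sqrt_add_sqrt_of_quadratic_nonneg h⟩
end

section
/- Let M be the 3×3 real symmetric matrix with zero diagonal and off-diagonal entries M₁₂ = α, M₁₃ = β, M₂₃ = γ, where α, β, γ ≥ 0. If M is conditionally negative definite, then √α ≤ √β + √γ, √β ≤ √α + √γ, and √γ ≤ √α + √β. -/
open Matrix

/-- A real symmetric `n×n` matrix is conditionally negative definite if `vᵀNv ≤ 0`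
for every `v` with `∑ᵢ vᵢ = 0`. -/
def CondNegDef {n : ℕ} (N : Matrix (Fin n) (Fin n) ℝ) : Prop :=
  ∀ v : Fin n → ℝ, (∑ i, v i) = 0 → v ⬝ᵥ N.mulVec v ≤ 0

theorem sqrt_le_sqrt_add_sqrt_of_sq_le {a b c : ℝ} (hb : 0 ≤ b) (hc : 0 ≤ c)
    (h : (a - b - c) ^ 2 ≤ 4 * b * c) :
    Real.sqrt a ≤ Real.sqrt b + Real.sqrt c := by
  have hb' := Real.sq_sqrt hb
  have hc' := Real.sq_sqrt hc
  have hbc : 0 ≤ 2 * (Real.sqrt b * Real.sqrt c) := by positivity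
  have key : a - b - c ≤ 2 * (Real.sqrt b * Real.sqrt c) := by
    refine le_of_abs_le (abs_le_of_sq_le_sq ?_ hbc)
    rw [mul_pow, mul_pow, hb', hc']
    linarith
  refine Real.sqrt_le_iff.2 ⟨by positivity, ?_⟩
  rw [add_sq, hb', hc']
  linarith

/-- Nonpositivity of the discriminant of the restricted quadratic form. -/
theorem CondNegDef.sq_le_four_mul {a b c : ℝ}
    (hM : CondNegDef (!![0, a, b; a, 0, c; b, c, 0] : Matrix (Fin 3) (Fin 3) ℝ)) :
    (a - b - c) ^ 2 ≤ 4 * b * c := by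
  have h : discrim b (b + c - a) c ≤ 0 := by
    refine discrim_le_zero fun x => ?_
    have hx := hM ![x, 1, -x - 1] (by simp [Fin.sum_univ_three])
    simp [Matrix.mulVec, dotProduct, Fin.sum_univ_three] at hx
    linarith
  rw [discrim] at h
  linarith

/-- If the `3×3` matrix with zero diagonal and off-diagonal entries `α, β, γ ≥ 0` is
conditionally negative definite, then `√α, √β, √γ` satisfy the triangle inequalities. -/
theorem triangle_of_cnd (a b c : ℝ) (ha : 0 ≤ a) (hb : 0 ≤ b) (hc : 0 ≤ c)
    (hM : CondNegDef (!![0, a, b; a, 0, c; b, c, 0] : Matrix (Fin 3) (Fin 3) ℝ)) :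
    Real.sqrt a ≤ Real.sqrt b + Real.sqrt c ∧
    Real.sqrt b ≤ Real.sqrt a + Real.sqrt c ∧
    Real.sqrt c ≤ Real.sqrt a + Real.sqrt b := by
  have h := hM.sq_le_four_mul
  exact ⟨sqrt_le_sqrt_add_sqrt_of_sq_le hb hc h,
    sqrt_le_sqrt_add_sqrt_of_sq_le ha hc (by linarith),
    sqrt_le_sqrt_add_sqrt_of_sq_le ha hb (by linarith)⟩
end

section
/- Let α, β, γ ≥ 0 satisfy the triangle inequalities √α ≤ √β + √γ, √β ≤ √α + √γ, and √γ ≤ √α + √β. Then the 3×3 real symmetric matrix M with zero diagonal and off-diagonal entries M₁₂ = α, M₁₃ = β, M₂₃ = γ is conditionally negative definite. -/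
open Matrix

/-- The binary quadratic form `q²x² + (q² + r² - p²)xy + r²y²` is nonnegative when `p, q, r`
are the side lengths of a (possibly degenerate) triangle. -/
lemma triangle_form_nonneg {p q r : ℝ} (hp : p ≤ q + r) (hq : q ≤ p + r) (hr : r ≤ p + q)
    (x y : ℝ) : 0 ≤ q ^ 2 * x ^ 2 + (q ^ 2 + r ^ 2 - p ^ 2) * (x * y) + r ^ 2 * y ^ 2 := by
  rcases le_total 0 (x * y) with h | h
  · have hpqr : 0 ≤ (q + r - p) * (q + r + p) :=
      mul_nonneg (by linarith) (by linarith)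
    linarith [sq_nonneg (q * x - r * y), mul_nonneg hpqr h]
  · have hpqr : 0 ≤ (p + r - q) * (p + q - r) :=
      mul_nonneg (by linarith) (by linarith)
    linarith [sq_nonneg (q * x + r * y), mul_nonpos_of_nonneg_of_nonpos hpqr h]

/-- If `√α, √β, √γ` satisfy the triangle inequalities (with `α, β, γ ≥ 0`), then the
`3×3` matrix with zero diagonal and off-diagonal entries `α, β, γ` is conditionally
negative definite. -/
theorem cnd_of_triangle (a b c : ℝ) (ha : 0 ≤ a) (hb : 0 ≤ b) (hc : 0 ≤ c)
    (h1 : Real.sqrt a ≤ Real.sqrt b + Real.sqrt c)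
    (h2 : Real.sqrt b ≤ Real.sqrt a + Real.sqrt c)
    (h3 : Real.sqrt c ≤ Real.sqrt a + Real.sqrt b) :
    CondNegDef (!![0, a, b; a, 0, c; b, c, 0] : Matrix (Fin 3) (Fin 3) ℝ) := by
  intro v hv
  have h := triangle_form_nonneg h1 h2 h3 (v 0) (v 1)
  rw [Real.sq_sqrt ha, Real.sq_sqrt hb, Real.sq_sqrt hc] at h
  have hv2 : v 2 = -(v 0 + v 1) := by
    rw [Fin.sum_univ_three] at hv
    linarith
  simp only [dotProduct, mulVec, Fin.sum_univ_three, of_apply, cons_val]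
  rw [hv2]
  linarith
end

section
/- Let h : ℙ_d → (0,∞) be concave (h(λX + (1−λ)Y) ≥ λh(X) + (1−λ)h(Y) for λ ∈ [0,1]) and suppose the divergence Δ_h(X,Y) := h((X+Y)/2) − (1/2)h(X) − (1/2)h(Y) satisfies √(Δ_h(X,Z)) ≤ √(Δ_h(X,Y)) + √(Δ_h(Y,Z)) for all X, Y, Z ∈ ℙ_d. Let F : (0,∞) → ℝ be completely monotonic. Then Δ_F(X,Y) := (1/2)F(h(X)) + (1/2)F(h(Y)) − F(h((X+Y)/2)) satisfies Δ_F(X,Y) ≥ 0 and √(Δ_F(X,Z)) ≤ √(Δ_F(X,Y)) + √(Δ_F(Y,Z)) for all X, Y, Z ∈ ℙ_d. -/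
open Matrix
open scoped ComplexOrder

/-- The Jensen divergence of a concave functional `h`:
`Δ_h(X,Y) = h((X+Y)/2) − (1/2)h(X) − (1/2)h(Y)`. -/
noncomputable def jensenH {d : ℕ} (h : Matrix (Fin d) (Fin d) ℂ → ℝ)
    (X Y : Matrix (Fin d) (Fin d) ℂ) : ℝ :=
  h ((1 / 2 : ℝ) • (X + Y)) - (1 / 2) * h X - (1 / 2) * h Y

/-- The divergence `Δ_F(X,Y) = (1/2)F(h(X)) + (1/2)F(h(Y)) − F(h((X+Y)/2))` obtained by
composing a completely monotonic `F` with a concave `h`. -/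
noncomputable def jensenFH {d : ℕ} (F : ℝ → ℝ) (h : Matrix (Fin d) (Fin d) ℂ → ℝ)
    (X Y : Matrix (Fin d) (Fin d) ℂ) : ℝ :=
  (1 / 2) * F (h X) + (1 / 2) * F (h Y) - F (h ((1 / 2 : ℝ) • (X + Y)))

open Filter Topology

/-- The divergence `jensenFH F h X Y` in terms of `a = h X`, `b = h Y` and `p = √(jensenH h X Y)`. -/
noncomputable def scalarDivergence (F : ℝ → ℝ) (a b p : ℝ) : ℝ :=
  (1 / 2) * F a + (1 / 2) * F b - F ((a + b) / 2 + p ^ 2)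

/-- `F` turns sides `p, q, r` with `r ≤ p + q` into divergences that are nonnegative and whose
square roots satisfy the triangle inequality. -/
def PreservesTriangle (F : ℝ → ℝ) : Prop :=
  ∀ a b c p q r : ℝ, 0 < a → 0 < b → 0 < c → 0 ≤ p → 0 ≤ q → 0 ≤ r → r ≤ p + q →
    0 ≤ scalarDivergence F a b p ∧
    √(scalarDivergence F a c r) ≤ √(scalarDivergence F a b p) + √(scalarDivergence F b c q)

theorem PreservesTriangle.nonneg {F : ℝ → ℝ} (hF : PreservesTriangle F) {a b p : ℝ}
    (ha : 0 < a) (hb : 0 < b) (hp : 0 ≤ p) : 0 ≤ scalarDivergence F a b p :=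
  (hF a b b p 0 0 ha hb hb hp le_rfl le_rfl (by linarith)).1

/-- Minkowski's inequality in `ℝ²`, in terms of the squares of the coordinates. -/
theorem sqrt_add_le_sqrt_add_sqrt_add {x x' y y' z z' : ℝ} (hx : 0 ≤ x) (hx' : 0 ≤ x')
    (hy : 0 ≤ y) (hy' : 0 ≤ y') (hz : 0 ≤ z) (hz' : 0 ≤ z') (h : √x ≤ √y + √z)
    (h' : √x' ≤ √y' + √z') : √(x + x') ≤ √(y + y') + √(z + z') := by
  have key : √y * √z + √y' * √z' ≤ √(y + y') * √(z + z') := by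
    rw [← Real.sqrt_mul (x := y + y') (add_nonneg hy hy')]
    apply Real.le_sqrt_of_sq_le
    nlinarith [Real.sq_sqrt hy, Real.sq_sqrt hz, Real.sq_sqrt hy', Real.sq_sqrt hz',
      sq_nonneg (√y * √z' - √y' * √z)]
  rw [Real.sqrt_le_left (by positivity)]
  have h1 : √x ^ 2 ≤ (√y + √z) ^ 2 := by gcongr
  have h2 : √x' ^ 2 ≤ (√y' + √z') ^ 2 := by gcongr
  rw [Real.sq_sqrt hx] at h1
  rw [Real.sq_sqrt hx'] at h2
  nlinarith [Real.sq_sqrt hy, Real.sq_sqrt hz, Real.sq_sqrt hy', Real.sq_sqrt hz',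
    Real.sq_sqrt (add_nonneg hy hy'), Real.sq_sqrt (add_nonneg hz hz')]

theorem PreservesTriangle.add {F G : ℝ → ℝ} (hF : PreservesTriangle F)
    (hG : PreservesTriangle G) : PreservesTriangle fun x ↦ F x + G x := by
  have hadd : ∀ a b p, scalarDivergence (fun x ↦ F x + G x) a b p =
      scalarDivergence F a b p + scalarDivergence G a b p := by
    intro a b p
    simp only [scalarDivergence]
    ring
  intro a b c p q r ha hb hc hp hq hr hpqr
  simp only [hadd]
  exact ⟨add_nonneg (hF.nonneg ha hb hp) (hG.nonneg ha hb hp),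
    sqrt_add_le_sqrt_add_sqrt_add (hF.nonneg ha hc hr) (hG.nonneg ha hc hr)
      (hF.nonneg ha hb hp) (hG.nonneg ha hb hp) (hF.nonneg hb hc hq) (hG.nonneg hb hc hq)
      (hF a b c p q r ha hb hc hp hq hr hpqr).2 (hG a b c p q r ha hb hc hp hq hr hpqr).2⟩

theorem PreservesTriangle.const_mul {F : ℝ → ℝ} (hF : PreservesTriangle F) {k : ℝ} (hk : 0 ≤ k) :
    PreservesTriangle fun x ↦ k * F x := by
  have hmul : ∀ a b p, scalarDivergence (fun x ↦ k * F x) a b p = k * scalarDivergence F a b p := by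
    intro a b p
    simp only [scalarDivergence]
    ring
  intro a b c p q r ha hb hc hp hq hr hpqr
  simp only [hmul, Real.sqrt_mul hk, ← mul_add]
  exact ⟨mul_nonneg hk (hF.nonneg ha hb hp),
    mul_le_mul_of_nonneg_left (hF a b c p q r ha hb hc hp hq hr hpqr).2 (Real.sqrt_nonneg k)⟩

theorem PreservesTriangle.sum {F : ℕ → ℝ → ℝ} (hF : ∀ k, PreservesTriangle (F k)) (n : ℕ) :
    PreservesTriangle fun x ↦ ∑ k ∈ Finset.range n, F k x := by
  induction n with
  | zero => simp [PreservesTriangle, scalarDivergence]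
  | succ n ih =>
    simp only [Finset.sum_range_succ]
    exact ih.add (hF n)

theorem PreservesTriangle.of_tendsto {F : ℝ → ℝ} {G : ℕ → ℝ → ℝ}
    (hG : ∀ n, PreservesTriangle (G n))
    (hlim : ∀ x, 0 < x → Tendsto (fun n ↦ G n x) atTop (𝓝 (F x))) : PreservesTriangle F := by
  have hdiv : ∀ a b p, 0 < a → 0 < b →
      Tendsto (fun n ↦ scalarDivergence (G n) a b p) atTop (𝓝 (scalarDivergence F a b p)) := by
    intro a b p ha hb
    exact (((hlim a ha).const_mul _).add ((hlim b hb).const_mul _)).sub (hlim _ (by positivity))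
  intro a b c p q r ha hb hc hp hq hr hpqr
  exact ⟨ge_of_tendsto' (hdiv a b p ha hb) fun n ↦ (hG n).nonneg ha hb hp,
    le_of_tendsto_of_tendsto' (hdiv a c r ha hc).sqrt
      ((hdiv a b p ha hb).sqrt.add (hdiv b c q hb hc).sqrt)
      fun n ↦ (hG n a b c p q r ha hb hc hp hq hr hpqr).2⟩

/-- The three-point case of positive definiteness of the Gaussian kernel on the line: the angles
`arccos (exp (-x ^ 2))` are subadditive in `x`. -/
theorem exp_neg_sq_mul_sub_sqrt_mul_sqrt_le {p q r : ℝ} (hp : 0 ≤ p) (hq : 0 ≤ q) (hr : 0 ≤ r)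
    (h : r ≤ p + q) :
    Real.exp (-p ^ 2) * Real.exp (-q ^ 2) -
        √(1 - Real.exp (-p ^ 2) ^ 2) * √(1 - Real.exp (-q ^ 2) ^ 2) ≤ Real.exp (-r ^ 2) := by
  have hmono : Real.exp (-p ^ 2) * Real.exp (-q ^ 2) * Real.exp (-(2 * p * q)) ≤
      Real.exp (-r ^ 2) := by
    rw [← Real.exp_add, ← Real.exp_add, Real.exp_le_exp]
    nlinarith
  have hbound : ∀ x : ℝ, 0 ≤ x →
      √2 * x * Real.exp (-x ^ 2) ≤ √(1 - Real.exp (-x ^ 2) ^ 2) := by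
    intro x hx
    apply Real.le_sqrt_of_sq_le
    have h1 : Real.exp (2 * x ^ 2) * Real.exp (-x ^ 2) ^ 2 = 1 := by
      rw [sq (Real.exp _), ← Real.exp_add, ← Real.exp_add, ← Real.exp_zero]
      congr 1
      ring
    have h2 := Real.add_one_le_exp (2 * x ^ 2)
    rw [mul_pow, mul_pow, Real.sq_sqrt (by norm_num)]
    nlinarith [sq_nonneg (Real.exp (-x ^ 2))]
  have hprod := mul_le_mul (hbound p hp) (hbound q hq) (by positivity) (by positivity)
  have h2 := Real.add_one_le_exp (-(2 * p * q))
  have h3 : √2 * p * Real.exp (-p ^ 2) * (√2 * q * Real.exp (-q ^ 2)) =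
      2 * p * q * (Real.exp (-p ^ 2) * Real.exp (-q ^ 2)) := by
    linear_combination p * q * Real.exp (-p ^ 2) * Real.exp (-q ^ 2) *
      Real.mul_self_sqrt (show (0 : ℝ) ≤ 2 by norm_num)
  have hE : 0 < Real.exp (-p ^ 2) * Real.exp (-q ^ 2) := by positivity
  nlinarith

/-- The triangle inequality for `u • e^{iα}`, `v` and `w • e^{-iβ}` in the plane, where
`cos α = e` and `cos β = f`. -/
theorem sqrt_cosine_law_le {u v w e f g : ℝ} (hu : 0 ≤ u) (hw : 0 ≤ w)
    (he : e ^ 2 ≤ 1) (hf : f ^ 2 ≤ 1) (hg : e * f - √(1 - e ^ 2) * √(1 - f ^ 2) ≤ g) :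
    √((u ^ 2 + w ^ 2) / 2 - u * w * g) ≤
      √((u ^ 2 + v ^ 2) / 2 - u * v * e) + √((v ^ 2 + w ^ 2) / 2 - v * w * f) := by
  have hs := Real.sq_sqrt (sub_nonneg.2 he)
  have ht := Real.sq_sqrt (sub_nonneg.2 hf)
  set s := √(1 - e ^ 2)
  set t := √(1 - f ^ 2)
  have hnorm : ∀ x y : ℝ, ‖(⟨x, y⟩ : ℂ)‖ = √(x ^ 2 + y ^ 2) := by
    intro x y
    rw [Complex.norm_def, Complex.normSq_mk]
    ring_nf
  have tri := norm_add_le (⟨u * e - v, u * s⟩ : ℂ) ⟨v - w * f, w * t⟩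
  have hadd : (⟨u * e - v, u * s⟩ : ℂ) + ⟨v - w * f, w * t⟩ = ⟨u * e - w * f, u * s + w * t⟩ := by
    apply Complex.ext <;> simp
  rw [hadd, hnorm, hnorm, hnorm] at tri
  have h1 : (u ^ 2 + v ^ 2) / 2 - u * v * e = ((u * e - v) ^ 2 + (u * s) ^ 2) / 2 := by
    linear_combination (-u ^ 2 / 2) * hs
  have h2 : (v ^ 2 + w ^ 2) / 2 - v * w * f = ((v - w * f) ^ 2 + (w * t) ^ 2) / 2 := by
    linear_combination (-w ^ 2 / 2) * ht
  have h3 : (u ^ 2 + w ^ 2) / 2 - u * w * g ≤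
      ((u * e - w * f) ^ 2 + (u * s + w * t) ^ 2) / 2 := by
    nlinarith [mul_nonneg hu hw]
  refine (Real.sqrt_le_sqrt h3).trans ?_
  rw [h1, h2, Real.sqrt_div' _ (by norm_num), Real.sqrt_div' _ (by norm_num),
    Real.sqrt_div' _ (by norm_num), ← add_div]
  gcongr

theorem preservesTriangle_exp_neg_mul {s : ℝ} (hs : 0 ≤ s) :
    PreservesTriangle fun x ↦ Real.exp (-(s * x)) := by
  have hdiv : ∀ a b p, scalarDivergence (fun x ↦ Real.exp (-(s * x))) a b p =
      (Real.exp (-(s * a) / 2) ^ 2 + Real.exp (-(s * b) / 2) ^ 2) / 2 -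
        Real.exp (-(s * a) / 2) * Real.exp (-(s * b) / 2) * Real.exp (-(√s * p) ^ 2) := by
    intro a b p
    simp only [scalarDivergence, ← Real.exp_nat_mul, ← Real.exp_add, mul_pow, Real.sq_sqrt hs]
    ring_nf
  have hle : ∀ x : ℝ, Real.exp (-x ^ 2) ≤ 1 := fun x ↦ Real.exp_le_one_iff.2 (by nlinarith)
  have hsq : ∀ x : ℝ, Real.exp (-x ^ 2) ^ 2 ≤ 1 := fun x ↦ pow_le_one₀ (by positivity) (hle x)
  intro a b c p q r _ _ _ hp hq hr hpqr
  simp only [hdiv]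
  constructor
  · have := hle (√s * p)
    have hpos : 0 ≤ Real.exp (-(s * a) / 2) * Real.exp (-(s * b) / 2) := by positivity
    nlinarith [sq_nonneg (Real.exp (-(s * a) / 2) - Real.exp (-(s * b) / 2))]
  · refine sqrt_cosine_law_le (by positivity) (by positivity) (hsq _) (hsq _)
      (exp_neg_sq_mul_sub_sqrt_mul_sqrt_le (by positivity) (by positivity) (by positivity) ?_)
    rw [← mul_add]
    gcongr

section CompletelyMonotonic

variable {F : ℝ → ℝ} (hF : ContDiffOn ℝ (⊤ : ℕ∞) F (Set.Ioi 0))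
  (hcm : ∀ (k : ℕ) (x : ℝ), 0 < x → 0 ≤ (-1 : ℝ) ^ k * iteratedDeriv k F x)

include hF in
/-- Taylor's theorem with Cauchy remainder, expanding to the left of `c`. -/
theorem exists_eq_sum_add_cauchy_remainder {x c : ℝ} (hx : 0 < x) (hxc : x < c) (n : ℕ) :
    ∃ y ∈ Set.Ioo x c, F x =
      ∑ k ∈ Finset.range (n + 1), (-1) ^ k * iteratedDeriv k F c / (k.factorial : ℝ) * (c - x) ^ k +
      (-1) ^ (n + 1) * iteratedDeriv (n + 1) F y * (y - x) ^ n / (n.factorial : ℝ) * (c - x) := by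
  have hsub : Set.uIcc c x ⊆ Set.Ioi 0 := by
    rw [Set.uIcc_of_ge hxc.le]
    exact fun y hy ↦ hx.trans_le hy.1
  have hu : UniqueDiffOn ℝ (Set.uIcc c x) := uniqueDiffOn_uIcc hxc.ne'
  have hderiv : ∀ (k : ℕ), ∀ y ∈ Set.uIcc c x,
      iteratedDerivWithin k F (Set.uIcc c x) y = iteratedDeriv k F y := fun k y hy ↦
    iteratedDerivWithin_eq_iteratedDeriv hu
      ((hF.contDiffAt (Ioi_mem_nhds (hsub hy))).of_le (by exact_mod_cast le_top)) hy
  have hF' := hF.mono hsub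
  obtain ⟨y, hy, h⟩ := taylor_mean_remainder_cauchy (n := n) hxc.ne'
    (hF'.of_le (by exact_mod_cast le_top))
    ((hF'.differentiableOn_iteratedDerivWithin (by exact_mod_cast ENat.natCast_lt_top n) hu).mono
      Set.Ioo_subset_Icc_self)
  rw [hderiv _ _ (Set.Ioo_subset_Icc_self hy), taylor_within_apply, sub_eq_iff_eq_add'] at h
  rw [Set.uIoo_of_ge hxc.le] at hy
  refine ⟨y, hy, h.trans ?_⟩
  congr 1
  · refine Finset.sum_congr rfl fun k _ ↦ ?_
    rw [hderiv _ _ Set.left_mem_uIcc, ← neg_sub c x, neg_pow, smul_eq_mul]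
    ring
  · rw [← neg_sub y x, neg_pow (y - x), pow_succ]
    ring

include hF hcm in
theorem taylor_term_le {x c : ℝ} (hx : 0 < x) (hxc : x < c) (n : ℕ) :
    (-1) ^ n * iteratedDeriv n F c / (n.factorial : ℝ) * (c - x) ^ n ≤ F x := by
  obtain ⟨y, ⟨hxy, hyc⟩, h⟩ := exists_eq_sum_add_cauchy_remainder hF hx hxc n
  have hcx := sub_nonneg.2 hxc.le
  have hyx := sub_nonneg.2 hxy.le
  have hrem : 0 ≤ (-1) ^ (n + 1) * iteratedDeriv (n + 1) F y * (y - x) ^ n / (n.factorial : ℝ) *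
      (c - x) := by
    have := hcm (n + 1) y (hx.trans hxy)
    positivity
  have hterm := Finset.single_le_sum
    (f := fun k ↦ (-1) ^ k * iteratedDeriv k F c / (k.factorial : ℝ) * (c - x) ^ k)
    (fun k _ ↦ by have := hcm k c (hx.trans hxc); positivity)
    (Finset.self_mem_range_succ n)
  linarith

include hF hcm in
/-- The Taylor series of a completely monotonic function at `c` converges to it on `(0, c)`. -/
theorem tendsto_taylor_sum {x c : ℝ} (hx : 0 < x) (hxc : x < c) :
    Tendsto (fun n : ℕ ↦ ∑ k ∈ Finset.range (n + 1),
      (-1) ^ k * iteratedDeriv k F c / (k.factorial : ℝ) * (c - x) ^ k) atTop (𝓝 (F x)) := by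
  set ρ := (c - x) / (c - x / 2) with hρ
  have hρ0 : 0 ≤ ρ := div_nonneg (by linarith) (by linarith)
  have hρ1 : ρ < 1 := (div_lt_one (by linarith)).2 (by linarith)
  have hF0 : 0 ≤ F (x / 2) := by simpa using hcm 0 (x / 2) (by positivity)
  set C := F (x / 2) * ((c - x) / (x / 2))
  have hlim : Tendsto (fun n : ℕ ↦ C * ((n + 1 : ℝ) * ρ ^ n)) atTop (𝓝 0) := by
    have h1 := (tendsto_self_mul_const_pow_of_lt_one hρ0 hρ1).add
      (tendsto_pow_atTop_nhds_zero_of_lt_one hρ0 hρ1)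
    simpa [add_mul] using h1.const_mul C
  have hrem : ∀ n : ℕ, 0 ≤ F x - ∑ k ∈ Finset.range (n + 1),
      (-1) ^ k * iteratedDeriv k F c / (k.factorial : ℝ) * (c - x) ^ k ∧
      F x - ∑ k ∈ Finset.range (n + 1),
        (-1) ^ k * iteratedDeriv k F c / (k.factorial : ℝ) * (c - x) ^ k ≤
      C * ((n + 1 : ℝ) * ρ ^ n) := by
    intro n
    obtain ⟨y, ⟨hxy, hyc⟩, h⟩ := exists_eq_sum_add_cauchy_remainder hF hx hxc n
    have hD := hcm (n + 1) y (hx.trans hxy)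
    have hcx : 0 ≤ c - x := by linarith
    have hyx : 0 ≤ y - x := by linarith
    have hyz : 0 < y - x / 2 := by linarith
    rw [sub_eq_of_eq_add' h]
    refine ⟨by positivity, ?_⟩
    have hterm := taylor_term_le hF hcm (half_pos hx) (show x / 2 < y by linarith) (n + 1)
    have hratio : (y - x) / (y - x / 2) ≤ ρ := by
      rw [hρ, div_le_div_iff₀ hyz (by linarith)]
      nlinarith
    calc
      _ = (-1) ^ (n + 1) * iteratedDeriv (n + 1) F y / ((n + 1).factorial : ℝ) *
            (y - x / 2) ^ (n + 1) *
            ((c - x) / (y - x / 2)) * ((n + 1 : ℝ) * ((y - x) / (y - x / 2)) ^ n) := by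
        rw [Nat.factorial_succ]
        push_cast
        rw [div_pow, pow_succ (y - x / 2)]
        generalize y - x / 2 = z at hyz
        field_simp
      _ ≤ F (x / 2) * ((c - x) / (x / 2)) * ((n + 1 : ℝ) * ρ ^ n) := by
        gcongr
        linarith
  have h0 := squeeze_zero (fun n ↦ (hrem n).1) (fun n ↦ (hrem n).2) hlim
  simpa using h0.const_sub (F x)

include hF hcm in
theorem preservesTriangle_of_completelyMonotonic : PreservesTriangle F := by
  have hc : ∀ n : ℕ, (0 : ℝ) < n + 1 := fun n ↦ by positivity
  have hmem : ∀ (n : ℕ) (x : ℝ), 0 < x →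
      0 < (n + 1 : ℝ) * (1 - Real.exp (-(x / (n + 1)))) := fun n x hx ↦
    mul_pos (hc n) (sub_pos.2 (Real.exp_lt_one_iff.2 (neg_neg_of_pos (div_pos hx (hc n)))))
  refine .of_tendsto (G := fun n x ↦ F ((n + 1 : ℝ) * (1 - Real.exp (-(x / (n + 1)))))) ?_ ?_
  · intro n
    have hn := hc n
    set c : ℝ := n + 1
    refine .of_tendsto (G := fun m x ↦ ∑ k ∈ Finset.range (m + 1),
      (-1) ^ k * iteratedDeriv k F c / (k.factorial : ℝ) * c ^ k *
        Real.exp (-(k / c * x))) (fun m ↦ ?_) ?_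
    · refine PreservesTriangle.sum (fun k ↦ ?_) (m + 1)
      refine (preservesTriangle_exp_neg_mul (by positivity)).const_mul ?_
      have := hcm k c hn
      positivity
    · intro x hx
      have hlt : c * (1 - Real.exp (-(x / c))) < c := by
        nlinarith [Real.exp_pos (-(x / c))]
      refine (tendsto_taylor_sum hF hcm (hmem n x hx) hlt).congr fun m ↦ ?_
      refine Finset.sum_congr rfl fun k _ ↦ ?_
      have : c - c * (1 - Real.exp (-(x / c))) = c * Real.exp (-(x / c)) := by ring
      rw [this, mul_pow, ← Real.exp_nat_mul, ← mul_assoc]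
      ring_nf
  · intro x hx
    refine ((hF.continuousOn.continuousAt (Ioi_mem_nhds hx)).tendsto).comp ?_
    have hd : HasDerivAt (fun t : ℝ ↦ 1 - Real.exp (-(x * t))) x 0 := by
      have := ((((hasDerivAt_id (0 : ℝ)).const_mul x).neg).exp).const_sub 1
      simpa using this
    have hinv : Tendsto (fun n : ℕ ↦ 1 / ((n : ℝ) + 1)) atTop (𝓝[≠] 0) :=
      tendsto_nhdsWithin_iff.2 ⟨tendsto_one_div_add_atTop_nhds_zero_nat,
        Eventually.of_forall fun n ↦ (one_div_pos.2 (hc n)).ne'⟩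
    have := (hasDerivAt_iff_tendsto_slope_zero.1 hd).comp hinv
    refine this.congr fun n ↦ ?_
    simp [div_eq_mul_inv]

end CompletelyMonotonic

/-- If `h : ℙ_d → (0,∞)` is concave and `√(Δ_h)` satisfies the triangle inequality, and
`F : (0,∞) → ℝ` is completely monotonic, then `Δ_F(X,Y) = (1/2)F(h(X)) + (1/2)F(h(Y)) −
F(h((X+Y)/2))` is nonnegative and `√(Δ_F)` satisfies the triangle inequality. -/
theorem jensenFH_sqrt_metric {d : ℕ} (h : Matrix (Fin d) (Fin d) ℂ → ℝ)
    (hpos : ∀ X : Matrix (Fin d) (Fin d) ℂ, X.PosDef → 0 < h X)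
    (hconc : ∀ X Y : Matrix (Fin d) (Fin d) ℂ, X.PosDef → Y.PosDef →
      ∀ l : ℝ, l ∈ Set.Icc (0:ℝ) 1 →
        l * h X + (1 - l) * h Y ≤ h (l • X + (1 - l) • Y))
    (htri : ∀ X Y Z : Matrix (Fin d) (Fin d) ℂ, X.PosDef → Y.PosDef → Z.PosDef →
      Real.sqrt (jensenH h X Z) ≤
        Real.sqrt (jensenH h X Y) + Real.sqrt (jensenH h Y Z))
    (F : ℝ → ℝ)
    (hFsmooth : ContDiffOn ℝ (⊤ : ℕ∞) F (Set.Ioi 0))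
    (hFcm : ∀ (k : ℕ) (x : ℝ), 0 < x →
      0 ≤ (-1 : ℝ) ^ k * iteratedDerivWithin k F (Set.Ioi 0) x) :
    ∀ X Y Z : Matrix (Fin d) (Fin d) ℂ, X.PosDef → Y.PosDef → Z.PosDef →
      0 ≤ jensenFH F h X Y ∧
      Real.sqrt (jensenFH F h X Z) ≤
        Real.sqrt (jensenFH F h X Y) + Real.sqrt (jensenFH F h Y Z) := by
  have hcm : ∀ (k : ℕ) (x : ℝ), 0 < x → 0 ≤ (-1 : ℝ) ^ k * iteratedDeriv k F x := by
    intro k x hx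
    rw [← iteratedDerivWithin_of_isOpen isOpen_Ioi (Set.mem_Ioi.2 hx)]
    exact hFcm k x hx
  have hF := preservesTriangle_of_completelyMonotonic hFsmooth hcm
  have hnonneg : ∀ X Y : Matrix (Fin d) (Fin d) ℂ, X.PosDef → Y.PosDef → 0 ≤ jensenH h X Y := by
    intro X Y hX hY
    have := hconc X Y hX hY (1 / 2) ⟨by norm_num, by norm_num⟩
    rw [show (1 : ℝ) - 1 / 2 = 1 / 2 by norm_num, ← smul_add] at this
    rw [jensenH]
    linarith
  have hdiv : ∀ X Y : Matrix (Fin d) (Fin d) ℂ, X.PosDef → Y.PosDef →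
      jensenFH F h X Y = scalarDivergence F (h X) (h Y) (√(jensenH h X Y)) := by
    intro X Y hX hY
    rw [jensenFH, scalarDivergence, Real.sq_sqrt (hnonneg X Y hX hY), jensenH]
    ring_nf
  intro X Y Z hX hY hZ
  rw [hdiv X Y hX hY, hdiv X Z hX hZ, hdiv Y Z hY hZ]
  exact hF _ _ _ _ _ _ (hpos X hX) (hpos Y hY) (hpos Z hZ) (Real.sqrt_nonneg _)
    (Real.sqrt_nonneg _) (Real.sqrt_nonneg _) (htri X Y Z hX hY hZ)
end
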